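/- arXiv:1407.3232 — 2 statements merged into one kernel-verified Lean document; each statement's English description precedes it below -/
import Mathlib

section
/- Let ε > 0 and z = e^ε + e^{-ε}, and let p be a computation-register state on Fin 2^n with p' = PPA(p). If for some index i one has p_i / p_{i+1} ≤ e^{2ε}, then p'_i ≤ e^ε (p_i + p_{i+1}) / z and p'_{i+1} ≥ e^{-ε} (p_i + p_{i+1}) / z; in particular p'_i / p'_{i+1} ≤ e^{2ε}. -/
open Real Filter

/-- The multiset of `2^(n+1)` joint probabilities `p i * e^±ε / z`,
sorted in decreasing order (as a list, largest first):
entry `j` of this list is `λ_{j+1}` in the 1-indexed notation of the paper. -/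
noncomputable def ppaSorted (n : ℕ) (ε : ℝ) (p : Fin (2^n) → ℝ) : List ℝ :=
  ((((Finset.univ : Finset (Fin (2^n))).val.map
      fun j => p j * Real.exp ε / (Real.exp ε + Real.exp (-ε))) +
    ((Finset.univ : Finset (Fin (2^n))).val.map
      fun j => p j * Real.exp (-ε) / (Real.exp ε + Real.exp (-ε)))).sort (· ≤ ·)).reverse

/-- One iteration of the Partner Pairing Algorithm with a reset qubit of
polarization ε: `p'_i = λ_{2i+1} + λ_{2i+2}` (1-indexed) of the sorted joint probabilities. -/
noncomputable def PPA (n : ℕ) (ε : ℝ) (p : Fin (2^n) → ℝ) : Fin (2^n) → ℝ :=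
  fun i => (ppaSorted n ε p).getD (2 * (i : ℕ)) 0 + (ppaSorted n ε p).getD (2 * (i : ℕ) + 1) 0

/-- A computation-register state: strictly positive entries, sorted in
decreasing order, summing to 1. -/
def IsCompState (n : ℕ) (p : Fin (2^n) → ℝ) : Prop :=
  (∀ i, 0 < p i) ∧ Antitone p ∧ ∑ i, p i = 1

open Finset in
theorem coe_ppaSorted (n : ℕ) (ε : ℝ) (p : Fin (2^n) → ℝ) :
    (ppaSorted n ε p : Multiset ℝ) =
      (univ : Finset (Fin (2^n))).val.map
        (fun j => p j * Real.exp ε / (Real.exp ε + Real.exp (-ε))) +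
      (univ : Finset (Fin (2^n))).val.map
        (fun j => p j * Real.exp (-ε) / (Real.exp ε + Real.exp (-ε))) := by
  rw [ppaSorted, Multiset.coe_reverse, Multiset.sort_eq]

theorem length_ppaSorted (n : ℕ) (ε : ℝ) (p : Fin (2^n) → ℝ) :
    (ppaSorted n ε p).length = 2 ^ n + 2 ^ n := by
  rw [← Multiset.coe_card, coe_ppaSorted]
  simp

theorem sortedGE_ppaSorted (n : ℕ) (ε : ℝ) (p : Fin (2^n) → ℝ) :
    (ppaSorted n ε p).Pairwise (· ≥ ·) := by
  rw [ppaSorted, List.pairwise_reverse]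
  exact Multiset.pairwise_sort _ _

open Finset in
theorem countP_ppaSorted (n : ℕ) (ε : ℝ) (p : Fin (2^n) → ℝ) (q : ℝ → Prop) [DecidablePred q] :
    (ppaSorted n ε p).countP (q ·) =
      #{j | q (p j * Real.exp ε / (Real.exp ε + Real.exp (-ε)))} +
      #{j | q (p j * Real.exp (-ε) / (Real.exp ε + Real.exp (-ε)))} := by
  rw [← Multiset.coe_countP, coe_ppaSorted, Multiset.countP_add, Multiset.countP_map,
    Multiset.countP_map]
  rfl

/-- A decreasing list with at most `m` entries above `t` has its `m`-th entry at most `t`. -/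
theorem List.Pairwise.getD_le_of_countP_le {l : List ℝ} (hl : l.Pairwise (· ≥ ·)) {m : ℕ} {t : ℝ}
    (hm : m < l.length) (h : l.countP (t < ·) ≤ m) : l.getD m 0 ≤ t := by
  rw [List.getD_eq_getElem _ _ hm]
  by_contra! hlt
  have hall : ∀ x ∈ l.take (m + 1), t < x := by
    intro x hx
    obtain ⟨j, hj, rfl⟩ := List.getElem_of_mem hx
    rw [List.getElem_take]
    have hjm : j ≤ m := by
      rw [List.length_take] at hj
      omega
    rcases hjm.eq_or_lt with rfl | hjm
    · exact hlt
    · exact hlt.trans_le (List.pairwise_iff_getElem.1 hl j m _ hm hjm)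
  have hcount : (l.take (m + 1)).countP (t < ·) = (l.take (m + 1)).length :=
    List.countP_eq_length.2 fun x hx => by simpa using hall x hx
  have hsub := (List.take_sublist (m + 1) l).countP_le (p := (t < ·))
  rw [hcount, List.length_take] at hsub
  omega

/-- A decreasing list with more than `m` entries at least `t` has its `m`-th entry at least `t`. -/
theorem List.Pairwise.le_getD_of_lt_countP {l : List ℝ} (hl : l.Pairwise (· ≥ ·)) {m : ℕ} {t : ℝ}
    (h : m < l.countP (t ≤ ·)) : t ≤ l.getD m 0 := by
  have hm : m < l.length := h.trans_le List.countP_le_length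
  rw [List.getD_eq_getElem _ _ hm]
  by_contra! hlt
  have hall : ∀ x ∈ l.drop m, x < t := by
    intro x hx
    obtain ⟨j, hj, rfl⟩ := List.getElem_of_mem hx
    rw [List.getElem_drop]
    rcases Nat.eq_zero_or_pos j with rfl | hj0
    · exact hlt
    · exact (List.pairwise_iff_getElem.1 hl m (m + j) hm _ (by omega)).trans_lt hlt
  have hcount : (l.drop m).countP (t ≤ ·) = 0 :=
    List.countP_eq_zero.2 fun x hx => by simpa using hall x hx
  have htake : (l.take m).countP (t ≤ ·) ≤ (l.take m).length := List.countP_le_length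
  rw [← List.take_append_drop m l, List.countP_append, hcount] at h
  rw [List.length_take] at htake
  omega

open Finset in
theorem Fin.card_filter_le_of_forall_lt {N m : ℕ} {q : Fin N → Prop} [DecidablePred q]
    (h : ∀ j, q j → (j : ℕ) < m) : #{j | q j} ≤ m := by
  rw [← card_range m, ← card_map Fin.valEmbedding]
  refine card_le_card fun x hx => ?_
  obtain ⟨j, hj, rfl⟩ := Finset.mem_map.1 hx
  exact mem_range.2 (h j (mem_filter.1 hj).2)

open Finset in
theorem Fin.le_card_filter_of_forall_lt {N m : ℕ} {q : Fin N → Prop} [DecidablePred q]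
    (hm : m ≤ N) (h : ∀ j : Fin N, (j : ℕ) < m → q j) : m ≤ #{j | q j} := by
  rw [← card_range m, ← card_map Fin.valEmbedding]
  refine card_le_card fun x hx => ?_
  have hx := mem_range.1 hx
  exact Finset.mem_map.2 ⟨⟨x, by omega⟩, mem_filter.2 ⟨mem_univ _, h _ hx⟩, rfl⟩

/-- if `p_i / p_{i+1} ≤ e^{2ε}` then
`p'_i ≤ e^ε (p_i + p_{i+1})/z`, `p'_{i+1} ≥ e^{-ε} (p_i + p_{i+1})/z`,
and in particular `p'_i / p'_{i+1} ≤ e^{2ε}`. -/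
theorem ppa_crossing_ratio_small (n : ℕ) (hn : 1 ≤ n) (ε : ℝ) (hε : 0 < ε)
    (p : Fin (2^n) → ℝ) (hp : IsCompState n p)
    (i : ℕ) (hi : i + 1 < 2^n)
    (hratio : p ⟨i, by omega⟩ / p ⟨i + 1, hi⟩ ≤ Real.exp (2 * ε)) :
    PPA n ε p ⟨i, by omega⟩ ≤
        Real.exp ε * (p ⟨i, by omega⟩ + p ⟨i + 1, hi⟩) / (Real.exp ε + Real.exp (-ε)) ∧
    PPA n ε p ⟨i + 1, hi⟩ ≥
        Real.exp (-ε) * (p ⟨i, by omega⟩ + p ⟨i + 1, hi⟩) / (Real.exp ε + Real.exp (-ε)) ∧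
    PPA n ε p ⟨i, by omega⟩ / PPA n ε p ⟨i + 1, hi⟩ ≤ Real.exp (2 * ε) := by
  obtain ⟨hpos, hanti, -⟩ := hp
  set a : Fin (2^n) := ⟨i, by omega⟩
  set b : Fin (2^n) := ⟨i + 1, hi⟩
  have hE : 0 < Real.exp ε := Real.exp_pos _
  have hF : 0 < Real.exp (-ε) := Real.exp_pos _
  have hz : 0 < Real.exp ε + Real.exp (-ε) := by positivity
  have hFE : Real.exp (-ε) ≤ Real.exp ε := Real.exp_le_exp.2 (by linarith)
  have hexp : Real.exp (2 * ε) * Real.exp (-ε) = Real.exp ε := by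
    rw [← Real.exp_add]
    ring_nf
  have hcross : p a * Real.exp (-ε) ≤ p b * Real.exp ε := by
    rw [div_le_iff₀ (hpos b)] at hratio
    calc p a * Real.exp (-ε) ≤ Real.exp (2 * ε) * p b * Real.exp (-ε) := by gcongr
      _ = p b * Real.exp ε := by rw [← hexp]; ring
  have hpE {j k : Fin (2^n)} (h : (j : ℕ) ≤ k) : p k * Real.exp ε ≤ p j * Real.exp ε :=
    mul_le_mul_of_nonneg_right (hanti h) hE.le
  have hpF {j k : Fin (2^n)} (h : (j : ℕ) ≤ k) : p k * Real.exp (-ε) ≤ p j * Real.exp (-ε) :=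
    mul_le_mul_of_nonneg_right (hanti h) hF.le
  have hpFE (j : Fin (2^n)) : p j * Real.exp (-ε) ≤ p j * Real.exp ε :=
    mul_le_mul_of_nonneg_left hFE (hpos j).le
  have hlen := length_ppaSorted n ε p
  have hsorted := sortedGE_ppaSorted n ε p
  have h₀ : (ppaSorted n ε p).getD (2 * i) 0 ≤
      p a * Real.exp ε / (Real.exp ε + Real.exp (-ε)) := by
    refine hsorted.getD_le_of_countP_le (by omega) ?_
    rw [countP_ppaSorted]
    simp only [div_lt_div_iff_of_pos_right hz]
    rw [two_mul]
    refine add_le_add (Fin.card_filter_le_of_forall_lt fun j hj => ?_)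
      (Fin.card_filter_le_of_forall_lt fun j hj => ?_) <;> by_contra! hij
    · exact hj.not_ge (hpE hij)
    · exact hj.not_ge ((hpFE j).trans (hpE hij))
  have h₁ : (ppaSorted n ε p).getD (2 * i + 1) 0 ≤
      p b * Real.exp ε / (Real.exp ε + Real.exp (-ε)) := by
    refine hsorted.getD_le_of_countP_le (by omega) ?_
    rw [countP_ppaSorted]
    simp only [div_lt_div_iff_of_pos_right hz]
    rw [show 2 * i + 1 = (i + 1) + i by ring]
    refine add_le_add (Fin.card_filter_le_of_forall_lt fun j hj => ?_)
      (Fin.card_filter_le_of_forall_lt fun j hj => ?_) <;> by_contra! hij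
    · exact hj.not_ge (hpE hij)
    · exact hj.not_ge ((hpF hij).trans hcross)
  have h₂ : p a * Real.exp (-ε) / (Real.exp ε + Real.exp (-ε)) ≤
      (ppaSorted n ε p).getD (2 * (i + 1)) 0 := by
    refine hsorted.le_getD_of_lt_countP ?_
    rw [countP_ppaSorted]
    simp only [div_le_div_iff_of_pos_right hz]
    rw [← Nat.succ_le_iff, show (2 * (i + 1)).succ = (i + 2) + (i + 1) by omega]
    refine add_le_add (Fin.le_card_filter_of_forall_lt (by omega) fun j hj => ?_)
      (Fin.le_card_filter_of_forall_lt (by omega) fun j hj => ?_)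
    · exact hcross.trans (hpE (Nat.le_of_lt_succ hj))
    · exact hpF (Nat.le_of_lt_succ hj)
  have h₃ : p b * Real.exp (-ε) / (Real.exp ε + Real.exp (-ε)) ≤
      (ppaSorted n ε p).getD (2 * (i + 1) + 1) 0 := by
    refine hsorted.le_getD_of_lt_countP ?_
    rw [countP_ppaSorted]
    simp only [div_le_div_iff_of_pos_right hz]
    rw [← Nat.succ_le_iff, show (2 * (i + 1) + 1).succ = (i + 2) + (i + 2) by omega]
    refine add_le_add (Fin.le_card_filter_of_forall_lt (by omega) fun j hj => ?_)
      (Fin.le_card_filter_of_forall_lt (by omega) fun j hj => ?_)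
    · exact (hpFE b).trans (hpE (Nat.le_of_lt_succ hj))
    · exact hpF (Nat.le_of_lt_succ hj)
  have hupper : PPA n ε p a ≤
      Real.exp ε * (p a + p b) / (Real.exp ε + Real.exp (-ε)) :=
    (add_le_add h₀ h₁).trans_eq (by ring)
  have hlower : Real.exp (-ε) * (p a + p b) / (Real.exp ε + Real.exp (-ε)) ≤ PPA n ε p b :=
    Eq.trans_le (by ring) (add_le_add h₂ h₃)
  have hsum : 0 < p a + p b := add_pos (hpos a) (hpos b)
  refine ⟨hupper, hlower, ?_⟩
  rw [div_le_iff₀ (lt_of_lt_of_le (by positivity) hlower)]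
  calc PPA n ε p a ≤ Real.exp ε * (p a + p b) / (Real.exp ε + Real.exp (-ε)) := hupper
    _ = Real.exp (2 * ε) * (Real.exp (-ε) * (p a + p b) / (Real.exp ε + Real.exp (-ε))) := by
      nth_rewrite 1 [← hexp]
      ring
    _ ≤ Real.exp (2 * ε) * PPA n ε p b := by gcongr
end

section
/- Let ε > 0, z = e^ε + e^{-ε}, and let p⁰ be a computation-register state on Fin 2^n satisfying p^0_i / p^0_{i+1} ≤ e^{2ε} for every index i (equivalently d^0_i ≤ 2ε where d_i = log(p_i/p_{i+1})). Define p^{t+1} = PPA(p^t). Then for every index i with 0 ≤ i ≤ 2^n − 1 the limit lim_{t→∞} p^t_i exists and equals e^{-2iε} · p^∞_0, where p^∞_0 = lim_{t→∞} p^t_0. -/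
open Real Filter

section Pairing

open Finset

/-- `P'` arises from `P` by sorting the joint values `a * P i`, `b * P i` (`i < N`) decreasingly and
adding up consecutive pairs. Sequences are indexed by `ℕ`, only indices below `N` matter. -/
def IsPairingStep (N : ℕ) (a b : ℝ) (P P' : ℕ → ℝ) : Prop :=
  ∃ lam : ℕ → ℝ, (∀ i < N, P' i = lam (2 * i) + lam (2 * i + 1)) ∧
    (∀ i j, i ≤ j → j < 2 * N → lam j ≤ lam i) ∧
    ∀ f : ℝ → ℝ, ∑ j ∈ range (2 * N), f (lam j) =
      ∑ i ∈ range N, f (a * P i) + ∑ i ∈ range N, f (b * P i)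

/-- A sorted probability vector whose consecutive ratios are at most `q`. -/
structure IsRatioState (N : ℕ) (q : ℝ) (P : ℕ → ℝ) : Prop where
  nonneg : ∀ i < N, 0 ≤ P i
  anti : ∀ i j, i ≤ j → j < N → P j ≤ P i
  sum_eq : ∑ i ∈ range N, P i = 1
  ratio : ∀ i, i + 1 < N → P i ≤ q * P (i + 1)

lemma sum_range_two_mul (f : ℕ → ℝ) (k : ℕ) :
    ∑ i ∈ range k, (f (2 * i) + f (2 * i + 1)) = ∑ j ∈ range (2 * k), f j := by
  induction k with
  | zero => simp
  | succ k ih =>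
    rw [sum_range_succ, ih, show 2 * (k + 1) = 2 * k + 1 + 1 by ring, sum_range_succ,
      sum_range_succ]
    ring

lemma sum_sub_le_sum_max (f : ℕ → ℝ) (c : ℝ) {m N : ℕ} (h : m ≤ N) :
    ∑ i ∈ range m, (f i - c) ≤ ∑ i ∈ range N, max (f i - c) 0 :=
  (sum_le_sum fun _ _ => le_max_left _ _).trans <|
    sum_le_sum_of_subset_of_nonneg (range_subset_range.2 h) fun _ _ _ => le_max_right _ _

/-- A set of indices below `N` containing `0` and all successors of elements of `S` is strictly
larger than `S`, unless it is everything. -/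
lemma card_lt_or_eq_of_succ_mem {N : ℕ} {S U : Finset ℕ} (hU : U ⊆ range N) (hSU : S ⊆ U)
    (h0 : S.Nonempty → 0 ∈ U) (hs : ∀ i ∈ S, i + 1 < N → i + 1 ∈ U) :
    #S = 0 ∨ #S < #U ∨ #U = N := by
  rcases S.eq_empty_or_nonempty with rfl | hne
  · simp
  rcases eq_or_ssubset_of_subset hSU with rfl | hlt
  · right; right
    have : ∀ i, i < N → i ∈ S := by
      intro i
      induction i with
      | zero => exact fun _ => h0 hne
      | succ i ih => exact fun hi => hs i (ih (by omega)) hi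
    have hS : S = range N := hU.antisymm fun i hi => this i (mem_range.1 hi)
    rw [hS, card_range]
  · exact Or.inr (Or.inl (card_lt_card hlt))

section Step

variable {N : ℕ} {a b q : ℝ} {P P' : ℕ → ℝ}

/-- Partial sums after a step dominate the sum of any choice of joint values; here the first `k + 2`
values `a * P i` and the first `k` values `b * P i`. -/
lemma IsPairingStep.partial_sum_le (h : IsPairingStep N a b P P') {k : ℕ} (hk : k + 1 < N) :
    a * ∑ i ∈ range (k + 2), P i + b * ∑ i ∈ range k, P i ≤ ∑ i ∈ range (k + 1), P' i := by
  obtain ⟨lam, hP', hanti, hsum⟩ := h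
  have e1 : ∑ i ∈ range (k + 1), P' i = ∑ j ∈ range (2 * (k + 1)), lam j := by
    rw [← sum_range_two_mul]
    exact sum_congr rfl fun i hi => hP' i (by have := mem_range.1 hi; omega)
  set c := lam (2 * (k + 1)) with hc
  have e2 : ∑ j ∈ range (2 * N), max (lam j - c) 0 = ∑ j ∈ range (2 * (k + 1)), (lam j - c) := by
    rw [← sum_subset (range_subset_range.2 (show 2 * (k + 1) ≤ 2 * N by omega))]
    · refine sum_congr rfl fun j hj => max_eq_left ?_
      have := hanti j (2 * (k + 1)) (mem_range.1 hj).le (by omega)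
      linarith
    · intro j hj hj'
      rw [mem_range] at hj hj'
      have := hanti (2 * (k + 1)) j (by omega) hj
      exact max_eq_right (by linarith)
  have e3 := hsum fun v => max (v - c) 0
  have e4 := sum_sub_le_sum_max (fun i => a * P i) c (show k + 2 ≤ N by omega)
  have e5 := sum_sub_le_sum_max (fun i => b * P i) c (show k ≤ N by omega)
  simp only [sum_sub_distrib, ← mul_sum, sum_const, card_range, nsmul_eq_mul] at e2 e4 e5
  push_cast at e2 e4 e5
  rw [e1]
  linarith

lemma IsPairingStep.value_le (hb : 0 < b) (hq : 1 < q) (ha : a = q * b) (hN : 2 ≤ N)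
    (hP : IsRatioState N q P) {lam : ℕ → ℝ}
    (hanti : ∀ i j, i ≤ j → j < 2 * N → lam j ≤ lam i)
    (hsum : ∀ f : ℝ → ℝ, ∑ j ∈ range (2 * N), f (lam j) =
      ∑ i ∈ range N, f (a * P i) + ∑ i ∈ range N, f (b * P i))
    {j : ℕ} (hj : j + 2 < 2 * N) : lam j ≤ q * lam (j + 2) := by
  by_contra! hlt
  set x := lam j
  set y := lam (j + 2)
  have count : ∀ (r : ℝ → Prop) [DecidablePred r], #{i ∈ range (2 * N) | r (lam i)} =
      #{i ∈ range N | r (a * P i)} + #{i ∈ range N | r (b * P i)} := by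
    intro r _
    have := hsum fun v => if r v then 1 else 0
    simp only [sum_boole] at this
    exact_mod_cast this
  have c1 := count fun v => x ≤ v
  have c2 := count fun v => y < v
  have hle : ∀ i < N, b * P i ≤ a * P i := fun i hi => by
    rw [ha]; nlinarith [mul_nonneg hb.le (hP.nonneg i hi)]
  have hnext : ∀ i, i + 1 < N → b * P i ≤ a * P (i + 1) := fun i hi => by
    rw [ha]; nlinarith [hP.ratio i hi]
  have hzero : ∀ i < N, b * P i ≤ a * P 0 := fun i hi =>
    (mul_le_mul_of_nonneg_left (hP.anti 0 i (Nat.zero_le i) hi) hb.le).trans (hle 0 (by omega))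
  have k1 : j + 1 ≤ #{i ∈ range (2 * N) | x ≤ lam i} := by
    rw [← card_range (j + 1)]
    refine card_le_card fun i hi => ?_
    rw [mem_range] at hi
    exact mem_filter.2 ⟨mem_range.2 (by omega), hanti i j (by omega) (by omega)⟩
  have k2 : #{i ∈ range (2 * N) | y < lam i} ≤ j + 2 := by
    rw [← card_range (j + 2)]
    refine card_le_card fun i hi => ?_
    rw [mem_filter, mem_range] at hi
    rw [mem_range]
    by_contra! hji
    exact absurd (hanti (j + 2) i hji hi.1) (not_le.2 hi.2)
  have k3 : #{i ∈ range N | x ≤ a * P i} ≤ #{i ∈ range N | y < b * P i} := by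
    refine card_le_card fun i hi => ?_
    rw [mem_filter] at hi ⊢
    refine ⟨hi.1, lt_of_mul_lt_mul_left ?_ (show (0 : ℝ) ≤ q by linarith)⟩
    calc q * y < x := hlt
      _ ≤ a * P i := hi.2
      _ = q * (b * P i) := by rw [ha]; ring
  have k4 : #{i ∈ range N | x ≤ b * P i} = 0 ∨
      #{i ∈ range N | x ≤ b * P i} < #{i ∈ range N | x ≤ a * P i} ∨
      #{i ∈ range N | x ≤ a * P i} = N := by
    refine card_lt_or_eq_of_succ_mem (filter_subset _ _) ?_ ?_ ?_
    · intro i hi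
      simp only [mem_filter, mem_range] at hi ⊢
      exact ⟨hi.1, hi.2.trans (hle i hi.1)⟩
    · rintro ⟨i, hi⟩
      simp only [mem_filter, mem_range] at hi ⊢
      exact ⟨by omega, hi.2.trans (hzero i hi.1)⟩
    · intro i hi hiN
      simp only [mem_filter, mem_range] at hi ⊢
      exact ⟨hiN, hi.2.trans (hnext i hiN)⟩
  have k5 : #{i ∈ range N | y < b * P i} = 0 ∨
      #{i ∈ range N | y < b * P i} < #{i ∈ range N | y < a * P i} ∨
      #{i ∈ range N | y < a * P i} = N := by
    refine card_lt_or_eq_of_succ_mem (filter_subset _ _) ?_ ?_ ?_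
    · intro i hi
      simp only [mem_filter, mem_range] at hi ⊢
      exact ⟨hi.1, hi.2.trans_le (hle i hi.1)⟩
    · rintro ⟨i, hi⟩
      simp only [mem_filter, mem_range] at hi ⊢
      exact ⟨by omega, hi.2.trans_le (hzero i hi.1)⟩
    · intro i hi hiN
      simp only [mem_filter, mem_range] at hi ⊢
      exact ⟨hiN, hi.2.trans_le (hnext i hiN)⟩
  have bound : #{i ∈ range N | y < b * P i} ≤ N := by
    simpa using card_filter_le (range N) fun i => y < b * P i
  omega

lemma IsPairingStep.isRatioState (h : IsPairingStep N a b P P') (hb : 0 < b) (hq : 1 < q)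
    (ha : a = q * b) (hab : a + b = 1) (hN : 2 ≤ N) (hP : IsRatioState N q P) :
    IsRatioState N q P' := by
  obtain ⟨lam, hP', hanti, hsum⟩ := h
  have ha0 : 0 < a := by rw [ha]; positivity
  have hlam : ∀ j < 2 * N, 0 ≤ lam j := by
    have h1 := hsum fun v => max (-v) 0
    rw [sum_eq_zero (s := range N) fun i hi => max_eq_right (by
        have := mul_nonneg ha0.le (hP.nonneg i (mem_range.1 hi)); linarith),
      sum_eq_zero (s := range N) fun i hi => max_eq_right (by
        have := mul_nonneg hb.le (hP.nonneg i (mem_range.1 hi)); linarith), add_zero,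
      sum_eq_zero_iff_of_nonneg fun _ _ => le_max_right _ _] at h1
    intro j hj
    have := h1 j (mem_range.2 hj)
    have := max_eq_right_iff.1 this
    linarith
  refine ⟨fun i hi => ?_, fun i j hij hj => ?_, ?_, fun i hi => ?_⟩
  · rw [hP' i hi]
    exact add_nonneg (hlam _ (by omega)) (hlam _ (by omega))
  · rw [hP' i (by omega), hP' j hj]
    exact add_le_add (hanti _ _ (by omega) (by omega)) (hanti _ _ (by omega) (by omega))
  · rw [sum_congr rfl fun i hi => hP' i (mem_range.1 hi), sum_range_two_mul]
    have := hsum id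
    simp only [id, ← mul_sum, hP.sum_eq] at this
    linarith
  · rw [hP' i (by omega), hP' (i + 1) hi, mul_add]
    exact add_le_add (IsPairingStep.value_le hb hq ha hN hP hanti hsum (by omega))
      (IsPairingStep.value_le hb hq ha hN hP hanti hsum (j := 2 * i + 1) (by omega))

end Step

/-- Iterating the pairing step from a ratio state converges to a geometric vector. -/
lemma exists_tendsto_of_isPairingStep {N : ℕ} {a b q : ℝ} {P : ℕ → ℕ → ℝ} (hb : 0 < b) (hq : 1 < q)
    (ha : a = q * b) (hab : a + b = 1) (hN : 2 ≤ N) (h0 : IsRatioState N q (P 0))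
    (hstep : ∀ t, IsPairingStep N a b (P t) (P (t + 1))) :
    ∃ L : ℝ, ∀ i < N, Tendsto (fun t => P t i) atTop (nhds (q⁻¹ ^ i * L)) := by
  have hst : ∀ t, IsRatioState N q (P t) := fun t => by
    induction t with
    | zero => exact h0
    | succ t ih => exact (hstep t).isRatioState hb hq ha hab hN ih
  have hgap : ∀ k, k + 1 < N → ∀ t, b * (q * P t (k + 1) - P t k) ≤
      ∑ i ∈ range (k + 1), P (t + 1) i - ∑ i ∈ range (k + 1), P t i := by
    intro k hk t
    have := (hstep t).partial_sum_le hk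
    rw [sum_range_succ _ (k + 1), sum_range_succ _ k] at this
    rw [sum_range_succ (P t) k]
    have e : a * (∑ i ∈ range k, P t i + P t k + P t (k + 1)) + b * ∑ i ∈ range k, P t i =
        (a + b) * (∑ i ∈ range k, P t i + P t k) + b * (q * P t (k + 1) - P t k) := by
      rw [ha]; ring
    rw [hab] at e
    linarith
  have hgap0 : ∀ k, k + 1 < N → ∀ t, 0 ≤ b * (q * P t (k + 1) - P t k) := fun k hk t =>
    mul_nonneg hb.le (sub_nonneg.2 ((hst t).ratio k hk))
  have hconv : ∀ k, k + 1 < N →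
      ∃ l, Tendsto (fun t => ∑ i ∈ range (k + 1), P t i) atTop (nhds l) := by
    intro k hk
    refine ⟨_, tendsto_atTop_ciSup (monotone_nat_of_le_succ fun t => ?_) ⟨1, ?_⟩⟩
    · have := hgap k hk t
      have := hgap0 k hk t
      linarith
    · rintro _ ⟨t, rfl⟩
      rw [← (hst t).sum_eq]
      exact sum_le_sum_of_subset_of_nonneg (range_subset_range.2 hk.le)
        fun i hi _ => (hst t).nonneg i (mem_range.1 hi)
  have hdiff : ∀ k, k + 1 < N →
      Tendsto (fun t => b * (q * P t (k + 1) - P t k)) atTop (nhds 0) := by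
    intro k hk
    obtain ⟨l, hl⟩ := hconv k hk
    have := (hl.comp (tendsto_add_atTop_nat 1)).sub hl
    rw [sub_self] at this
    exact squeeze_zero (hgap0 k hk) (hgap k hk) this
  obtain ⟨L, hL⟩ := hconv 0 hN
  refine ⟨L, fun i => ?_⟩
  induction i with
  | zero => intro _; simpa using hL
  | succ i ih =>
    intro hi
    have h1 := (((hdiff i hi).const_mul b⁻¹).add (ih (by omega))).const_mul q⁻¹
    have hq0 : q ≠ 0 := by linarith
    convert h1 using 1
    · ext t
      field_simp
      ring
    · rw [pow_succ]
      congr 1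
      ring

lemma sum_univ_fin_dite {N : ℕ} (p : Fin N → ℝ) (f : ℝ → ℝ) :
    ∑ i ∈ range N, f (if h : i < N then p ⟨i, h⟩ else 0) = ∑ i, f (p i) := by
  rw [Finset.sum_range]
  simp

lemma ppaSorted_pairwise (n : ℕ) (ε : ℝ) (p : Fin (2 ^ n) → ℝ) :
    (ppaSorted n ε p).Pairwise (· ≥ ·) := by
  rw [ppaSorted, List.pairwise_reverse]
  exact Multiset.pairwise_sort _ _

lemma ppaSorted_coe (n : ℕ) (ε : ℝ) (p : Fin (2 ^ n) → ℝ) :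
    (ppaSorted n ε p : Multiset ℝ) =
      (univ : Finset (Fin (2 ^ n))).val.map
        (fun j => p j * Real.exp ε / (Real.exp ε + Real.exp (-ε))) +
      (univ : Finset (Fin (2 ^ n))).val.map
        (fun j => p j * Real.exp (-ε) / (Real.exp ε + Real.exp (-ε))) := by
  rw [ppaSorted, Multiset.coe_reverse, Multiset.sort_eq]

lemma ppaSorted_length (n : ℕ) (ε : ℝ) (p : Fin (2 ^ n) → ℝ) :
    (ppaSorted n ε p).length = 2 * 2 ^ n := by
  rw [← Multiset.coe_card, ppaSorted_coe]
  simp [two_mul]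

lemma isPairingStep_PPA (n : ℕ) (ε : ℝ) (p : Fin (2 ^ n) → ℝ) :
    IsPairingStep (2 ^ n) (Real.exp ε / (Real.exp ε + Real.exp (-ε)))
      (Real.exp (-ε) / (Real.exp ε + Real.exp (-ε)))
      (fun i => if h : i < 2 ^ n then p ⟨i, h⟩ else 0)
      (fun i => if h : i < 2 ^ n then PPA n ε p ⟨i, h⟩ else 0) := by
  have hlen := ppaSorted_length n ε p
  refine ⟨fun j => (ppaSorted n ε p).getD j 0, fun i hi => ?_, fun i j hij hj => ?_, fun f => ?_⟩
  · simp [hi, PPA]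
  · rcases hij.eq_or_lt with rfl | hij
    · rfl
    · have := List.pairwise_iff_getElem.1 (ppaSorted_pairwise n ε p) i j (by omega) (by omega) hij
      simpa [List.getD_eq_getElem, hlen, hj, hij.trans hj] using this
  · have h1 : ((ppaSorted n ε p : Multiset ℝ).map f).sum =
        ∑ j ∈ range (2 * 2 ^ n), f ((ppaSorted n ε p).getD j 0) := by
      rw [Multiset.map_coe, Multiset.sum_coe, ← hlen, Finset.sum_range, ← Fin.sum_univ_fun_getElem]
      simp
    rw [← h1, ppaSorted_coe, Multiset.map_add, Multiset.sum_add, Multiset.map_map,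
      Multiset.map_map, sum_univ_fin_dite p fun v => f (_ * v),
      sum_univ_fin_dite p fun v => f (_ * v)]
    simp only [Function.comp_def, Finset.sum, mul_comm, mul_div_assoc]

end Pairing

/-- if the initial state satisfies `p⁰_i / p⁰_{i+1} ≤ e^{2ε}` for
every `i`, then every `p^t_i` converges as `t → ∞`, with limit
`e^{-2iε} · p^∞_0` where `p^∞_0 = lim_t p^t_0`. -/
theorem ppa_asymptotic_state (n : ℕ) (hn : 1 ≤ n) (ε : ℝ) (hε : 0 < ε)
    (p : ℕ → Fin (2^n) → ℝ) (h0 : IsCompState n (p 0))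
    (hstep : ∀ t, p (t + 1) = PPA n ε (p t))
    (hratio : ∀ i : ℕ, ∀ hi : i + 1 < 2^n,
      p 0 ⟨i, by omega⟩ / p 0 ⟨i + 1, hi⟩ ≤ Real.exp (2 * ε)) :
    ∃ L : ℝ, Tendsto (fun t => p t ⟨0, Nat.two_pow_pos n⟩) atTop (nhds L) ∧
      ∀ i : Fin (2^n),
        Tendsto (fun t => p t i) atTop (nhds (Real.exp (-(2 * (i : ℕ) * ε)) * L)) := by
  have hN : 2 ≤ 2 ^ n := by simpa using Nat.pow_le_pow_right (n := 2) (by norm_num) hn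
  have hz : 0 < Real.exp ε + Real.exp (-ε) := by positivity
  have hq0 : 0 < Real.exp (2 * ε) := Real.exp_pos _
  obtain ⟨hpos, hanti, hsum⟩ := h0
  have hstate : IsRatioState (2 ^ n) (Real.exp (2 * ε))
      (fun i => if h : i < 2 ^ n then p 0 ⟨i, h⟩ else 0) := by
    refine ⟨fun i hi => ?_, fun i j hij hj => ?_, ?_, fun i hi => ?_⟩
    · simpa [hi] using (hpos ⟨i, hi⟩).le
    · simpa [hj, hij.trans_lt hj] using hanti (Fin.mk_le_mk.2 hij)
    · rw [← hsum]
      exact sum_univ_fin_dite (p 0) id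
    · have := (div_le_iff₀ (hpos _)).1 (hratio i hi)
      simpa [hi, (Nat.lt_succ_self i).trans hi] using this
  obtain ⟨L, hL⟩ := exists_tendsto_of_isPairingStep
    (P := fun t i => if h : i < 2 ^ n then p t ⟨i, h⟩ else 0)
    (a := Real.exp ε / (Real.exp ε + Real.exp (-ε)))
    (b := Real.exp (-ε) / (Real.exp ε + Real.exp (-ε))) (by positivity)
    (Real.one_lt_exp_iff.2 (by linarith))
    (by rw [← mul_div_assoc, ← Real.exp_add]; ring_nf) (by rw [← add_div, div_self hz.ne'])
    hN hstate (fun t => by simpa only [hstep t] using isPairingStep_PPA n ε (p t))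
  refine ⟨L, by simpa using hL 0 (Nat.two_pow_pos n), fun i => ?_⟩
  have h := hL i i.2
  simp only [i.2, dite_true, Fin.eta] at h
  convert h using 3
  rw [← Real.exp_neg, ← Real.exp_nat_mul]
  ring_nf
end
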